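/- Let w ∈ X with w ≠ 0. Then there exists no proper, convex, lower semicontinuous function f : X → ℝ ∪ {+∞} satisfying the functional equation f(x) = f(x + w) + ⟨w, x⟩ for all x ∈ X. -/

import Mathlib

open scoped RealInnerProductSpace

/-- if `w ≠ 0`, then there is no proper, convex, lower semicontinuous
function `f : X → ℝ ∪ {+∞}` (modelled as `f : X → EReal` never taking the value `⊥`)
satisfying `f(x) = f(x + w) + ⟪w, x⟫` for all `x`. -/
theorem no_proper_convex_lsc_solution_of_translation_equation
    {X : Type*} [NormedAddCommGroup X] [InnerProductSpace ℝ X] [CompleteSpace X] [Nontrivial X]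
    (w : X) (hw : w ≠ 0) :
    ¬ ∃ f : X → EReal,
        (∀ x : X, f x ≠ ⊥) ∧
        (∃ x : X, f x ≠ ⊤) ∧
        (∀ x y : X, ∀ a b : ℝ, 0 ≤ a → 0 ≤ b → a + b = 1 →
          f (a • x + b • y) ≤ (a : EReal) * f x + (b : EReal) * f y) ∧
        LowerSemicontinuous f ∧
        (∀ x : X, f x = f (x + w) + ((⟪w, x⟫ : ℝ) : EReal)) := by
  rintro ⟨f, hbot, ⟨x, hx⟩, hconv, -, heq⟩
  have h0 := heq x
  have h1 := heq (x + w)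
  have hx1 : f (x + w) ≠ ⊤ := by
    intro h
    rw [h, EReal.top_add_coe] at h0
    exact hx h0
  have hx2 : f (x + w + w) ≠ ⊤ := by
    intro h
    rw [h, EReal.top_add_coe] at h1
    exact hx1 h1
  have hc := hconv x (x + w + w) (1 / 2) (1 / 2) (by norm_num) (by norm_num) (by norm_num)
  have hmid : ((1 / 2 : ℝ) • x + (1 / 2 : ℝ) • (x + w + w)) = x + w := by
    module
  rw [hmid] at hc
  lift f x to ℝ using ⟨hx, hbot x⟩ with a ha
  lift f (x + w) to ℝ using ⟨hx1, hbot _⟩ with b hb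
  lift f (x + w + w) to ℝ using ⟨hx2, hbot _⟩ with c hc'
  norm_cast at h0 h1 hc
  rw [inner_add_right] at h1
  have hpos : 0 < ⟪w, w⟫ := real_inner_self_pos.mpr hw
  linarith
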